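/- For all α ≥ 0, β ≥ 0, ℓ ≥ 0 and every t > 0 one has ∫₀^α ∫₀^β e^{−(x+ℓ+y)²/(4t)} dy dx = 2·√π·t·( H(ℓ/(2√t)) − H((α+ℓ)/(2√t)) − H((β+ℓ)/(2√t)) + H((α+β+ℓ)/(2√t)) ). -/

import Mathlib

open MeasureTheory

/-- The complementary error function `erfc(x) = (2/√π) ∫_x^∞ e^{−s²} ds`. -/
noncomputable def erfc (x : ℝ) : ℝ :=
  (2 / Real.sqrt Real.pi) * ∫ s in Set.Ioi x, Real.exp (-s ^ 2)

/-- The function `H(x) = (1/√π)·e^{−x²} − x·erfc(x)`. -/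
noncomputable def H (x : ℝ) : ℝ :=
  (1 / Real.sqrt Real.pi) * Real.exp (-x ^ 2) - x * erfc x

theorem integrableOn_exp_neg_sq (s : Set ℝ) :
    IntegrableOn (fun x : ℝ => Real.exp (-x ^ 2)) s := by
  have h := integrable_exp_neg_mul_sq (b := 1) one_pos
  simp only [neg_mul, one_mul] at h
  exact h.integrableOn

theorem hasDerivAt_erfc (x : ℝ) :
    HasDerivAt erfc (-(2 / Real.sqrt Real.pi * Real.exp (-x ^ 2))) x := by
  have hcont : Continuous fun s : ℝ => Real.exp (-s ^ 2) := by fun_prop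
  have herfc : erfc = fun u => (2 / Real.sqrt Real.pi) *
      ((∫ s in Set.Ioi (0 : ℝ), Real.exp (-s ^ 2)) - ∫ s in (0 : ℝ)..u, Real.exp (-s ^ 2)) := by
    funext u
    have h := intervalIntegral.integral_interval_add_Ioi'
      (hcont.intervalIntegrable (μ := volume) 0 u) (integrableOn_exp_neg_sq (Set.Ioi u))
    rw [erfc, ← h, add_sub_cancel_left]
  rw [herfc]
  refine (((hcont.integral_hasStrictDerivAt 0 x).hasDerivAt.const_sub _).const_mul
    (2 / Real.sqrt Real.pi)).congr_deriv ?_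
  ring

theorem continuous_erfc : Continuous erfc :=
  continuous_iff_continuousAt.2 fun x => (hasDerivAt_erfc x).continuousAt

theorem hasDerivAt_H (x : ℝ) : HasDerivAt H (-erfc x) x := by
  have hexp : HasDerivAt (fun u : ℝ => Real.exp (-u ^ 2)) (Real.exp (-x ^ 2) * (-(2 * x))) x := by
    simpa using ((hasDerivAt_id x).pow 2).neg.exp
  refine ((hexp.const_mul (1 / Real.sqrt Real.pi)).sub
    ((hasDerivAt_id x).mul (hasDerivAt_erfc x))).congr_deriv ?_
  simp only [id]
  ring

theorem integral_exp_neg_sq_div_eq_erfc {c : ℝ} (hc : c ≠ 0) (a β : ℝ) :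
    ∫ y in (0 : ℝ)..β, Real.exp (-((a + y) / c) ^ 2) =
      Real.sqrt Real.pi * c / 2 * (erfc (a / c) - erfc ((a + β) / c)) := by
  have hderiv (y : ℝ) : HasDerivAt
      (fun y => -(Real.sqrt Real.pi * c / 2) * erfc ((a + y) / c))
      (Real.exp (-((a + y) / c) ^ 2)) y := by
    have hinner : HasDerivAt (fun y : ℝ => (a + y) / c) (1 / c) y :=
      ((hasDerivAt_id y).const_add a).div_const c
    refine (((hasDerivAt_erfc ((a + y) / c)).comp y hinner).const_mul
      (-(Real.sqrt Real.pi * c / 2))).congr_deriv ?_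
    have hpi : Real.sqrt Real.pi ≠ 0 := (Real.sqrt_pos.2 Real.pi_pos).ne'
    generalize Real.exp (-((a + y) / c) ^ 2) = E
    field_simp
  rw [intervalIntegral.integral_eq_sub_of_hasDerivAt (fun y _ => hderiv y)
    (Continuous.intervalIntegrable (by fun_prop) _ _), add_zero]
  ring

theorem integral_erfc_div {c : ℝ} (hc : c ≠ 0) (b α : ℝ) :
    ∫ x in (0 : ℝ)..α, erfc ((x + b) / c) = c * (H (b / c) - H ((α + b) / c)) := by
  have hderiv (x : ℝ) : HasDerivAt (fun x => -c * H ((x + b) / c)) (erfc ((x + b) / c)) x := by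
    have hinner : HasDerivAt (fun x : ℝ => (x + b) / c) (1 / c) x :=
      ((hasDerivAt_id x).add_const b).div_const c
    refine (((hasDerivAt_H ((x + b) / c)).comp x hinner).const_mul (-c)).congr_deriv ?_
    field_simp
  rw [intervalIntegral.integral_eq_sub_of_hasDerivAt (fun x _ => hderiv x)
    (Continuous.intervalIntegrable (continuous_erfc.comp (by fun_prop)) _ _), zero_add]
  ring

/-- For all `α, β, ℓ ≥ 0` and `t > 0`,
`∫₀^α ∫₀^β e^{−(x+ℓ+y)²/(4t)} dy dx
  = 2√π·t·(H(ℓ/(2√t)) − H((α+ℓ)/(2√t)) − H((β+ℓ)/(2√t)) + H((α+β+ℓ)/(2√t)))`. -/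
theorem double_integral_shifted_gaussian (α β ℓ t : ℝ)
    (hα : 0 ≤ α) (hβ : 0 ≤ β) (hℓ : 0 ≤ ℓ) (ht : 0 < t) :
    (∫ x in (0 : ℝ)..α, ∫ y in (0 : ℝ)..β, Real.exp (-(x + ℓ + y) ^ 2 / (4 * t)))
      = 2 * Real.sqrt Real.pi * t *
          (H (ℓ / (2 * Real.sqrt t)) - H ((α + ℓ) / (2 * Real.sqrt t))
            - H ((β + ℓ) / (2 * Real.sqrt t)) + H ((α + β + ℓ) / (2 * Real.sqrt t))) := by
  have hsqrt : Real.sqrt t ^ 2 = t := Real.sq_sqrt ht.le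
  have hc : 2 * Real.sqrt t ≠ 0 := mul_ne_zero two_ne_zero (Real.sqrt_pos.2 ht).ne'
  have hexp (x y : ℝ) : -(x + ℓ + y) ^ 2 / (4 * t) = -((x + ℓ + y) / (2 * Real.sqrt t)) ^ 2 := by
    rw [div_pow, mul_pow, hsqrt, neg_div]
    norm_num
  have hintegrable (b : ℝ) : IntervalIntegrable (fun x => erfc ((x + b) / (2 * Real.sqrt t)))
      volume 0 α :=
    (continuous_erfc.comp (by fun_prop)).intervalIntegrable _ _
  simp only [hexp, integral_exp_neg_sq_div_eq_erfc hc, add_assoc _ ℓ β]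
  rw [intervalIntegral.integral_const_mul, intervalIntegral.integral_sub (hintegrable _) (hintegrable _),
    integral_erfc_div hc, integral_erfc_div hc, add_comm ℓ β, ← add_assoc]
  linear_combination 2 * Real.sqrt Real.pi * (H (ℓ / (2 * Real.sqrt t))
    - H ((α + ℓ) / (2 * Real.sqrt t)) - H ((β + ℓ) / (2 * Real.sqrt t))
    + H ((α + β + ℓ) / (2 * Real.sqrt t))) * hsqrt
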